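/- For any dynamical system (X, ℤ) on a compact metric space X, the mean dimension of Borel's construction satisfies mdim(X ×_ℤ ℝ) = mdim(X), where X ×_ℤ ℝ carries the ℤ-action obtained by restricting the natural ℝ-action. -/

import Mathlib

/-- The order of a finite family of sets: the maximal number of its members
having a common point. -/
noncomputable def ordCover {X : Type*} (A : Finset (Set X)) : ℕ :=
  sSup {n : ℕ | ∃ x : X, ∃ B ⊆ A, B.card = n ∧ ∀ s ∈ B, x ∈ s}

/-- Gromov's mean dimension of the ℤ-system generated by a homeomorphism `T` of a
compact metric space:  `mdim = inf { d > 0 : ∀ ε > 0 there is a finite open cover A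
with mesh(A + z) < ε for all integers z with 0 ≤ z·d < ord A }`. -/
noncomputable def mdim {X : Type*} [MetricSpace X] (T : X ≃ₜ X) : ℝ :=
  sInf {d : ℝ | 0 < d ∧ ∀ ε : ℝ, 0 < ε → ∃ A : Finset (Set X),
    (∀ s ∈ A, IsOpen s) ∧ (∀ x : X, ∃ s ∈ A, x ∈ s) ∧
    ∀ z : ℕ, (z : ℝ) * d < (ordCover A : ℝ) →
      ∀ s ∈ A, Metric.diam ((fun x => (T.toEquiv ^ (z : ℤ)) x) '' s) < ε}

/-- The relation on `X × ℝ` generated by the diagonal ℤ-action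
`(x, t) + z = (x + z, t + z)`, where `x + z = T^z x`. -/
def borelRel {X : Type*} [TopologicalSpace X] (T : X ≃ₜ X) :
    X × ℝ → X × ℝ → Prop :=
  fun p q => ∃ z : ℤ, q.1 = (T.toEquiv ^ z) p.1 ∧ q.2 = p.2 + z

/-- Borel's construction `X ×_ℤ ℝ = (X × ℝ)/ℤ`. -/
def BorelConstruction {X : Type*} [TopologicalSpace X] (T : X ≃ₜ X) : Type _ :=
  Quot (borelRel T)

instance {X : Type*} [TopologicalSpace X] (T : X ≃ₜ X) :
    TopologicalSpace (BorelConstruction T) :=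
  instTopologicalSpaceQuot

/-- The ℝ-action on `X ×_ℤ ℝ` induced by `(x, t) + r = (x, t + r)`. -/
def borelAct {X : Type*} [TopologicalSpace X] (T : X ≃ₜ X) (r : ℝ) :
    BorelConstruction T → BorelConstruction T :=
  Quot.map (fun p => (p.1, p.2 + r)) (by
    rintro ⟨x, t⟩ ⟨y, s⟩ ⟨z, h1, h2⟩
    exact ⟨z, h1, by dsimp at h2 ⊢; rw [h2]; ring⟩)

section Covers

variable {X Y : Type*}

theorem card_le_ordCover (A : Finset (Set X)) (x : X) {B : Finset (Set X)} (hB : B ⊆ A)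
    (hx : ∀ s ∈ B, x ∈ s) : B.card ≤ ordCover A := by
  refine le_csSup ⟨A.card, ?_⟩ ⟨x, B, hB, rfl, hx⟩
  rintro n ⟨_, C, hC, rfl, _⟩
  exact Finset.card_le_card hC

theorem ncard_le_ordCover (A : Finset (Set X)) (x : X) :
    {s : A | x ∈ s.1}.ncard ≤ ordCover A := by
  classical
  rw [Set.ncard_eq_toFinset_card']
  rw [← Finset.card_image_of_injective _ Subtype.val_injective]
  refine card_le_ordCover A x ?_ ?_
  · intro s hs
    obtain ⟨a, _, rfl⟩ := Finset.mem_image.1 hs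
    exact a.2
  · intro s hs
    obtain ⟨a, ha, rfl⟩ := Finset.mem_image.1 hs
    simpa using ha

theorem ordCover_image_univ_le {ι : Type*} [Fintype ι] [DecidableEq (Set X)] (U : ι → Set X)
    {K : ℕ} (hK : ∀ x, {i | x ∈ U i}.ncard ≤ K) : ordCover (Finset.univ.image U) ≤ K := by
  classical
  refine csSup_le' ?_
  rintro n ⟨x, B, hB, rfl, hx⟩
  refine le_trans ?_ (hK x)
  rw [Set.ncard_eq_toFinset_card']
  refine (Finset.card_le_card (t := Finset.image U {i | x ∈ U i}.toFinset) ?_).trans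
    Finset.card_image_le
  intro s hs
  obtain ⟨i, -, rfl⟩ := Finset.mem_image.1 (hB hs)
  exact Finset.mem_image_of_mem U (by simpa using hx _ hs)

/-- The condition on `d` in the definition of `mdim`, for a bijection of a metric space. -/
def HasFineCovers [MetricSpace X] (e : Equiv.Perm X) (d : ℝ) : Prop :=
  0 < d ∧ ∀ ε : ℝ, 0 < ε → ∃ A : Finset (Set X),
    (∀ s ∈ A, IsOpen s) ∧ (∀ x : X, ∃ s ∈ A, x ∈ s) ∧
    ∀ z : ℕ, (z : ℝ) * d < (ordCover A : ℝ) →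
      ∀ s ∈ A, Metric.diam ((fun x => (e ^ (z : ℤ)) x) '' s) < ε

theorem mdim_eq_sInf [MetricSpace X] (T : X ≃ₜ X) :
    mdim T = sInf {d | HasFineCovers T.toEquiv d} := rfl

/-- Fine covers may be given as indexed families, with the diameter bounds replaced by bounds
on distances. -/
theorem HasFineCovers.of_indexed [MetricSpace X] {e : Equiv.Perm X} {d : ℝ} (hd : 0 < d)
    (H : ∀ ε : ℝ, 0 < ε → ∃ (ι : Type*) (_ : Fintype ι) (U : ι → Set X) (K : ℕ),
      (∀ i, IsOpen (U i)) ∧ (∀ x, ∃ i, x ∈ U i) ∧ (∀ x, {i | x ∈ U i}.ncard ≤ K) ∧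
      ∀ z : ℕ, (z : ℝ) * d < K → ∀ i, ∀ x ∈ U i, ∀ y ∈ U i,
        dist ((e ^ z) x) ((e ^ z) y) < ε) : HasFineCovers e d := by
  classical
  refine ⟨hd, fun ε hε => ?_⟩
  obtain ⟨ι, _, U, K, hU, hcov, hK, hdist⟩ := H (ε / 2) (half_pos hε)
  refine ⟨Finset.univ.image U, ?_, ?_, ?_⟩
  · intro s hs
    obtain ⟨i, -, rfl⟩ := Finset.mem_image.1 hs
    exact hU i
  · intro x
    obtain ⟨i, hi⟩ := hcov x
    exact ⟨U i, Finset.mem_image_of_mem U (Finset.mem_univ i), hi⟩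
  · intro z hz s hs
    obtain ⟨i, -, rfl⟩ := Finset.mem_image.1 hs
    refine lt_of_le_of_lt (Metric.diam_le_of_forall_dist_le (half_pos hε).le ?_) (half_lt_self hε)
    rintro _ ⟨x, hx, rfl⟩ _ ⟨y, hy, rfl⟩
    have := hdist z (hz.trans_le (by exact_mod_cast ordCover_image_univ_le U hK)) i x hx y hy
    simpa using this.le

theorem HasFineCovers.exists_dist_lt [MetricSpace X] [CompactSpace X] {e : Equiv.Perm X} {d : ℝ}
    (H : HasFineCovers e d) {ε : ℝ} (hε : 0 < ε) : ∃ A : Finset (Set X),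
      (∀ s ∈ A, IsOpen s) ∧ (∀ x : X, ∃ s ∈ A, x ∈ s) ∧
      ∀ z : ℕ, (z : ℝ) * d < (ordCover A : ℝ) → ∀ s ∈ A, ∀ x ∈ s, ∀ y ∈ s,
        dist ((e ^ z) x) ((e ^ z) y) < ε := by
  obtain ⟨A, hA, hcov, hdiam⟩ := H.2 ε hε
  refine ⟨A, hA, hcov, fun z hz s hs x hx y hy => ?_⟩
  have := (Metric.dist_le_diam_of_mem Metric.isBounded_of_compactSpace
    (Set.mem_image_of_mem _ hx) (Set.mem_image_of_mem _ hy)).trans_lt (hdiam z hz s hs)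
  simpa using this

theorem HasFineCovers.of_injective [MetricSpace X] [CompactSpace X] [MetricSpace Y]
    [CompactSpace Y] {e : Equiv.Perm X} {e' : Equiv.Perm Y} {f : X → Y} (hf : Continuous f)
    (hinj : Function.Injective f) (hconj : ∀ x, f (e x) = e' (f x)) {d : ℝ}
    (H : HasFineCovers e' d) : HasFineCovers e d := by
  refine .of_indexed H.1 fun ε hε => ?_
  have hemb := (hf.isClosedEmbedding hinj).isEmbedding
  have : CompactSpace (Set.range f) := isCompact_iff_compactSpace.1 (isCompact_range hf)
  obtain ⟨δ, hδ, hfδ⟩ := Metric.uniformContinuous_iff.1 (CompactSpace.uniformContinuous_of_continuous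
    hemb.toHomeomorph.symm.continuous) ε hε
  replace hfδ : ∀ x y, dist (f x) (f y) < δ → dist x y < ε := fun x y hxy => by
    simpa using @hfδ (hemb.toHomeomorph x) (hemb.toHomeomorph y) hxy
  obtain ⟨A, hA, hcov, hdist⟩ := H.exists_dist_lt hδ
  have hpow : ∀ (z : ℕ) x, f ((e ^ z) x) = (e' ^ z) (f x) := by
    intro z x
    rw [← Equiv.Perm.iterate_eq_pow, ← Equiv.Perm.iterate_eq_pow]
    exact (Function.Semiconj.iterate_right (f := f) hconj z) x
  refine ⟨A, inferInstance, fun s => f ⁻¹' s.1, ordCover A, fun s => (hA s s.2).preimage hf,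
    fun x => ?_, fun x => ncard_le_ordCover A (f x), fun z hz s x hx y hy => hfδ _ _ ?_⟩
  · obtain ⟨s, hs, hx⟩ := hcov (f x)
    exact ⟨⟨s, hs⟩, hx⟩
  · rw [hpow, hpow]
    exact hdist z hz s s.2 _ hx _ hy

theorem Homeomorph.continuous_toEquiv_zpow [TopologicalSpace X] (T : X ≃ₜ X) (z : ℤ) :
    Continuous (T.toEquiv ^ z) := by
  have hpow : ∀ (R : X ≃ₜ X) (n : ℕ), Continuous (R.toEquiv ^ n) := fun R n => by
    rw [← Equiv.Perm.iterate_eq_pow]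
    exact R.continuous.iterate n
  cases z with
  | ofNat n => simpa using hpow T n
  | negSucc n =>
    rw [zpow_negSucc, ← inv_pow]
    exact hpow T.symm (n + 1)

theorem HasFineCovers.inv [MetricSpace X] [CompactSpace X] {T : X ≃ₜ X} {d : ℝ}
    (H : HasFineCovers T.toEquiv d) : HasFineCovers T.toEquiv⁻¹ d := by
  refine .of_indexed H.1 fun ε hε => ?_
  obtain ⟨A, hA, hcov, hdist⟩ := H.exists_dist_lt hε
  have hd := H.1
  set N : ℕ := ⌈(ordCover A : ℝ) / d⌉₊
  have hN : ∀ z : ℕ, (z : ℝ) * d < ordCover A ↔ z < N := fun z => by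
    rw [Nat.lt_ceil, lt_div_iff₀ hd]
  refine ⟨A, inferInstance, fun s => (T.toEquiv ^ (-(N : ℤ) + 1)) ⁻¹' s.1, ordCover A,
    fun s => (hA s s.2).preimage (T.continuous_toEquiv_zpow _), fun x => ?_,
    fun x => ncard_le_ordCover A _, fun z hz s x hx y hy => ?_⟩
  · obtain ⟨s, hs, hx⟩ := hcov ((T.toEquiv ^ (-(N : ℤ) + 1)) x)
    exact ⟨⟨s, hs⟩, hx⟩
  · have hzN := (hN z).1 hz
    have key : ∀ x, (T.toEquiv⁻¹ ^ z) x =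
        (T.toEquiv ^ (N - 1 - z)) ((T.toEquiv ^ (-(N : ℤ) + 1)) x) := by
      intro x
      rw [← zpow_natCast, ← zpow_natCast, inv_zpow', ← Equiv.Perm.mul_apply, ← zpow_add]
      congr 2
      omega
    rw [key, key]
    exact hdist _ ((hN _).2 (by omega)) s s.2 _ hx _ hy

end Covers

section Join

universe u

variable {Y : Type*} [TopologicalSpace Y] [NormalSpace Y]

/-- Two families of disjoint half-open intervals have few overlapping pairs of members: such a
pair is determined by the member with the larger left end. -/
theorem ncard_overlap_le {ι κ α : Type*} [Finite ι] [Finite κ] [LinearOrder α]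
    {a b : ι → α} {c d : κ → α} {I : Set ι} {J : Set κ}
    (hI : ∀ i ∈ I, ∀ i' ∈ I, ∀ t, a i ≤ t → t < b i → a i' ≤ t → t < b i' → i = i')
    (hJ : ∀ j ∈ J, ∀ j' ∈ J, ∀ t, c j ≤ t → t < d j → c j' ≤ t → t < d j' → j = j') :
    {p : ι × κ | p.1 ∈ I ∧ p.2 ∈ J ∧ a p.1 < b p.1 ∧ c p.2 < d p.2 ∧
      a p.1 < d p.2 ∧ c p.2 < b p.1}.ncard ≤ I.ncard + J.ncard := by
  classical
  set P := {p : ι × κ | p.1 ∈ I ∧ p.2 ∈ J ∧ a p.1 < b p.1 ∧ c p.2 < d p.2 ∧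
      a p.1 < d p.2 ∧ c p.2 < b p.1}
  have h1 : (P ∩ {p | c p.2 ≤ a p.1}).ncard ≤ I.ncard := by
    refine Set.ncard_le_ncard_of_injOn Prod.fst (fun p hp => hp.1.1) ?_ (Set.toFinite _)
    rintro ⟨i, j⟩ ⟨⟨-, h2, -, -, h5, -⟩, h⟩ ⟨i', j'⟩ ⟨⟨-, h2', -, -, h5', -⟩, h'⟩ rfl
    exact Prod.ext rfl (hJ j h2 j' h2' (a i) h h5 h' h5')
  have h2 : (P \ {p | c p.2 ≤ a p.1}).ncard ≤ J.ncard := by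
    refine Set.ncard_le_ncard_of_injOn Prod.snd (fun p hp => hp.1.2.1) ?_ (Set.toFinite _)
    rintro ⟨i, j⟩ ⟨⟨h1, -, -, -, -, h6⟩, h⟩ ⟨i', j'⟩ ⟨⟨h1', -, -, -, -, h6'⟩, h'⟩ rfl
    exact Prod.ext (hI i h1 i' h1' (c j) (not_le.1 h).le h6 (not_le.1 h').le h6') rfl
  have := Set.ncard_inter_add_ncard_sdiff_eq_ncard P {p | c p.2 ≤ a p.1} (Set.toFinite _)
  omega

/-- A finite open cover of a normal space gives rise to a subdivision of an interval into
consecutive intervals `[a i y, b i y)`, depending continuously on `y`. -/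
theorem exists_interval_subdivision {ι : Type*} [Fintype ι] {U : ι → Set Y}
    (hU : ∀ i, IsOpen (U i)) (hcov : ∀ y, ∃ i, y ∈ U i) :
    ∃ a b : ι → Y → ℝ, (∀ i, Continuous (a i)) ∧ (∀ i, Continuous (b i)) ∧
      (∀ i y, a i y < b i y → y ∈ U i) ∧ (∀ y, ∃ i, a i y ≤ 0 ∧ 0 < b i y) ∧
      ∀ y i i' t, a i y ≤ t → t < b i y → a i' y ≤ t → t < b i' y → i = i' := by
  classical
  let _ : LinearOrder ι := linearOrderOfSTO WellOrderingRel
  obtain ⟨f, hf⟩ := PartitionOfUnity.exists_isSubordinate_of_locallyFinite (s := Set.univ)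
    isClosed_univ U hU (locallyFinite_of_finite U) (fun y _ => Set.mem_iUnion.2 (hcov y))
  refine ⟨fun i y => ∑ j with j < i, f j y, fun i y => (∑ j with j < i, f j y) + f i y,
    fun i => by fun_prop, fun i => by fun_prop, fun i y h => ?_, fun y => ?_, ?_⟩
  · refine hf i (subset_closure ?_)
    simp only [lt_add_iff_pos_right] at h
    exact h.ne'
  · have hne : (Finset.univ.filter fun i => 0 < f i y).Nonempty := by
      obtain ⟨i, hi⟩ := f.exists_pos (Set.mem_univ y)
      exact ⟨i, by simpa using hi⟩
    set i := Finset.min' _ hne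
    have hi : 0 < f i y := by simpa using Finset.min'_mem _ hne
    have h0 : ∑ j with j < i, f j y = 0 := Finset.sum_eq_zero fun j hj => by
      by_contra hj0
      have hpos : 0 < f j y := lt_of_le_of_ne (f.nonneg j y) (Ne.symm hj0)
      exact absurd (Finset.min'_le _ j (by simpa using hpos))
        (not_le.2 (Finset.mem_filter.1 hj).2)
    exact ⟨i, h0.le, by simpa [h0] using hi⟩
  · have key : ∀ y i i', i < i' →
        (∑ j with j < i, f j y) + f i y ≤ ∑ j with j < i', f j y := by
      intro y i i' h
      have : (∑ j with j < i, f j y) + f i y = ∑ j ∈ insert i (Finset.univ.filter (· < i)), f j y := by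
        rw [Finset.sum_insert (by simp), add_comm]
      rw [this]
      refine Finset.sum_le_sum_of_subset_of_nonneg (fun j hj => ?_) fun j _ _ => f.nonneg j y
      rcases Finset.mem_insert.1 hj with rfl | hj
      · simpa using h
      · simpa using (Finset.mem_filter.1 hj).2.trans h
    intro y i i' t h1 h2 h3 h4
    rcases lt_trichotomy i i' with h | h | h
    · have := key y i i' h
      linarith
    · exact h
    · have := key y i' i h
      linarith

theorem exists_join {ι κ : Type*} [Fintype ι] [Fintype κ] {U : ι → Set Y} {V : κ → Set Y}
    (hU : ∀ i, IsOpen (U i)) (hUcov : ∀ y, ∃ i, y ∈ U i)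
    (hV : ∀ i, IsOpen (V i)) (hVcov : ∀ y, ∃ i, y ∈ V i) :
    ∃ W : ι × κ → Set Y, (∀ p, IsOpen (W p)) ∧ (∀ y, ∃ p, y ∈ W p) ∧
      (∀ p, W p ⊆ U p.1 ∩ V p.2) ∧
      ∀ y, {p | y ∈ W p}.ncard ≤ {i | y ∈ U i}.ncard + {j | y ∈ V j}.ncard := by
  obtain ⟨a, b, ha, hb, hab, hab0, habd⟩ := exists_interval_subdivision hU hUcov
  obtain ⟨c, d, hc, hd, hcd, hcd0, hcdd⟩ := exists_interval_subdivision hV hVcov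
  refine ⟨fun p => {y | a p.1 y < b p.1 y ∧ c p.2 y < d p.2 y ∧ a p.1 y < d p.2 y ∧
    c p.2 y < b p.1 y}, fun p => ?_, fun y => ?_, fun p y hy => ⟨hab _ _ hy.1, hcd _ _ hy.2.1⟩,
    fun y => ?_⟩
  · exact (isOpen_lt (ha _) (hb _)).inter ((isOpen_lt (hc _) (hd _)).inter
      ((isOpen_lt (ha _) (hd _)).inter (isOpen_lt (hc _) (hb _))))
  · obtain ⟨i, hi⟩ := hab0 y
    obtain ⟨j, hj⟩ := hcd0 y
    exact ⟨(i, j), hi.1.trans_lt hi.2, hj.1.trans_lt hj.2, hi.1.trans_lt hj.2, hj.1.trans_lt hi.2⟩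
  · refine le_trans (Set.ncard_le_ncard ?_ (Set.toFinite _))
      (ncard_overlap_le (I := {i | y ∈ U i}) (J := {j | y ∈ V j}) (a := fun i => a i y)
        (b := fun i => b i y) (c := fun i => c i y) (d := fun i => d i y)
        (fun i _ i' _ => habd y i i') (fun j _ j' _ => hcdd y j j'))
    intro p hp
    exact ⟨hab _ _ hp.1, hcd _ _ hp.2.1, hp⟩

theorem exists_common_refinement {ι : Type u} [Fintype ι] (U : ℕ → ι → Set Y)
    (hU : ∀ q i, IsOpen (U q i)) (p : ℕ) (hcov : ∀ q ≤ p, ∀ y, ∃ i, y ∈ U q i) :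
    ∃ (κ : Type u) (_ : Fintype κ) (W : κ → Set Y), (∀ k, IsOpen (W k)) ∧ (∀ y, ∃ k, y ∈ W k) ∧
      (∀ k, ∀ q ≤ p, ∃ i, W k ⊆ U q i) ∧
      ∀ y, {k | y ∈ W k}.ncard ≤ ∑ q ∈ Finset.range (p + 1), {i | y ∈ U q i}.ncard := by
  induction p with
  | zero =>
    refine ⟨ι, inferInstance, U 0, hU 0, hcov 0 le_rfl, fun k q hq => ⟨k, ?_⟩, fun y => by simp⟩
    rw [Nat.le_zero.1 hq]
  | succ p ih =>
    obtain ⟨κ, _, W, hW, hWcov, href, hcard⟩ := ih fun q hq => hcov q (by omega)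
    obtain ⟨W', hW', hW'cov, href', hcard'⟩ := exists_join hW hWcov (hU (p + 1)) (hcov _ le_rfl)
    refine ⟨κ × ι, inferInstance, W', hW', hW'cov, fun k q hq => ?_, fun y => ?_⟩
    · rcases Nat.le_succ_iff.1 hq with hq | rfl
      · obtain ⟨i, hi⟩ := href k.1 q hq
        exact ⟨i, fun y hy => hi (href' k hy).1⟩
      · exact ⟨k.2, fun y hy => (href' k hy).2⟩
    · rw [Finset.sum_range_succ]
      exact (hcard' y).trans (Nat.add_le_add_right (hcard y) _)

end Join

section Bricks

variable {X Y : Type*} {π : X × ℝ → Y}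

/-- The image in a quotient of `X × ℝ` of the box `e ^ ((a % p) * N) s × (a / L, (a + p + 1) / L)`. -/
def brick (π : X × ℝ → Y) (e : Equiv.Perm X) (p L N a : ℕ) (s : Set X) : Set Y :=
  π '' {w | (e ^ (-((a % p * N : ℕ) : ℤ))) w.1 ∈ s ∧ (a : ℝ) < L * w.2 ∧ L * w.2 < a + p + 1}

theorem isOpen_brick [TopologicalSpace X] [TopologicalSpace Y] {T : X ≃ₜ X}
    (hopen : IsOpenMap π) (p L N a : ℕ) {s : Set X} (hs : IsOpen s) :
    IsOpen (brick π T.toEquiv p L N a s) := by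
  refine hopen _ (IsOpen.inter ?_ (IsOpen.inter ?_ ?_))
  · exact hs.preimage ((T.continuous_toEquiv_zpow _).comp continuous_fst)
  · exact isOpen_lt (f := fun _ => (a : ℝ)) (g := fun w : X × ℝ => L * w.2)
      (by fun_prop) (by fun_prop)
  · exact isOpen_lt (f := fun w : X × ℝ => L * w.2) (g := fun _ => (a : ℝ) + p + 1)
      (by fun_prop) (by fun_prop)

theorem mem_brick_iff {e : Equiv.Perm X}
    (hπ : ∀ x t x' t', π (x, t) = π (x', t') ↔ ∃ z : ℤ, x' = (e ^ z) x ∧ t' = t + z)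
    {p L N a : ℕ} {s : Set X} {x : X} {t : ℝ} :
    π (x, t) ∈ brick π e p L N a s ↔ ∃ n : ℤ, (e ^ (n - ((a % p * N : ℕ) : ℤ))) x ∈ s ∧
      (a : ℝ) < L * (t + n) ∧ L * (t + n) < a + p + 1 := by
  have key : ∀ n : ℤ, (e ^ (n - ((a % p * N : ℕ) : ℤ))) x =
      (e ^ (-((a % p * N : ℕ) : ℤ))) ((e ^ n) x) := fun n => by
    rw [← Equiv.Perm.mul_apply, ← zpow_add, sub_eq_neg_add]
  constructor
  · rintro ⟨⟨x', t'⟩, ⟨h1, h2, h3⟩, h4⟩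
    obtain ⟨n, rfl, rfl⟩ := (hπ _ _ _ _).1 h4.symm
    exact ⟨n, by rwa [key], h2, h3⟩
  · rintro ⟨n, h1, h2, h3⟩
    exact ⟨((e ^ n) x, t + n), ⟨by rwa [key] at h1, h2, h3⟩,
      ((hπ _ _ _ _).2 ⟨n, rfl, rfl⟩).symm⟩

theorem exists_mem_brick {e : Equiv.Perm X}
    (hπ : ∀ x t x' t', π (x, t) = π (x', t') ↔ ∃ z : ℤ, x' = (e ^ z) x ∧ t' = t + z)
    {p L N q : ℕ} (hL : 0 < L) (hpL : p ∣ L) (hq : q < p) {A : Finset (Set X)}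
    (hA : ∀ x : X, ∃ s ∈ A, x ∈ s) (x : X) (t : ℝ) :
    ∃ a < L, a % p = q ∧ ∃ s ∈ A, π (x, t) ∈ brick π e p L N a s := by
  have hp : (0 : ℝ) < p := by exact_mod_cast (by omega : 0 < p)
  set c : ℤ := ⌈(L * t - q) / p⌉ - 1 with hc
  have hc1 : (q : ℝ) + p * c < L * t := by
    have : (c : ℝ) < (L * t - q) / p := by
      rw [hc]; push_cast; linarith [Int.ceil_lt_add_one ((L * t - q) / (p : ℝ))]
    rw [lt_div_iff₀ hp] at this
    linarith
  have hc2 : (L : ℝ) * t ≤ q + p * c + p := by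
    have : (L * t - q) / (p : ℝ) ≤ c + 1 := by
      rw [hc]; push_cast; linarith [Int.le_ceil ((L * t - q) / (p : ℝ))]
    rw [div_le_iff₀ hp] at this
    linarith
  set b : ℤ := q + p * c with hb
  have hL' : (0 : ℤ) < L := by exact_mod_cast hL
  obtain ⟨a, ha⟩ := Int.eq_ofNat_of_zero_le (Int.emod_nonneg b hL'.ne')
  have haL : a < L := by
    have := Int.emod_lt_of_pos b hL'
    omega
  have hdiv := Int.emod_add_mul_ediv b L
  rw [ha] at hdiv
  have haR : (a : ℝ) + L * (b / L : ℤ) = q + p * c := by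
    have : ((a + L * (b / L) : ℤ) : ℝ) = (b : ℤ) := by rw [hdiv]
    rw [hb] at this
    push_cast at this
    rw [hb]
    exact this
  have hap : a % p = q := by
    have h1 : (a : ℤ) ≡ b [ZMOD p] :=
      (ha ▸ Int.mod_modEq b L : (a : ℤ) ≡ b [ZMOD L]).of_dvd (by exact_mod_cast hpL)
    have h2 : b ≡ q [ZMOD p] := by
      rw [hb]
      exact (Int.modEq_iff_dvd.2 ⟨-c, by ring⟩)
    have h3 : a ≡ q [MOD p] := Int.natCast_modEq_iff.1 (h1.trans h2)
    rw [h3, Nat.mod_eq_of_lt hq]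
  obtain ⟨s, hs, hxs⟩ := hA ((e ^ (-(b / L) - ((a % p * N : ℕ) : ℤ))) x)
  refine ⟨a, haL, hap, s, hs, (mem_brick_iff hπ).2 ⟨-(b / L), hxs, ?_, ?_⟩⟩ <;>
  · push_cast
    linarith

theorem ncard_mem_brick_le {e : Equiv.Perm X}
    (hπ : ∀ x t x' t', π (x, t) = π (x', t') ↔ ∃ z : ℤ, x' = (e ^ z) x ∧ t' = t + z)
    (p L N : ℕ) (A : Finset (Set X)) (x : X) (t : ℝ) :
    {i : Fin L × A | π (x, t) ∈ brick π e p L N i.1 i.2}.ncard ≤ (p + 1) * ordCover A := by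
  classical
  set R : ℤ → Finset (Fin L × A) := fun b => Finset.univ.filter fun i =>
    ∃ n : ℤ, (i.1 : ℤ) = b + L * n ∧ (e ^ (n - ((i.1 % p * N : ℕ) : ℤ))) x ∈ i.2.1
  have hR : ∀ b, (R b).card ≤ ordCover A := by
    intro b
    rcases (R b).eq_empty_or_nonempty with h | ⟨⟨a, j⟩, hi⟩
    · simp [h]
    obtain ⟨n, hn, -⟩ := (Finset.mem_filter.1 hi).2
    have huniq : ∀ i ∈ R b, i.1 = a ∧
        (e ^ (n - (((a : ℕ) % p * N : ℕ) : ℤ))) x ∈ i.2.1 := by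
      rintro ⟨a', j'⟩ hi'
      obtain ⟨n', hn', hx⟩ := (Finset.mem_filter.1 hi').2
      dsimp only at hn hn' hx ⊢
      have h1 := a.2
      have h2 := a'.2
      have hL : (0 : ℤ) < L := by omega
      have hnn : n' = n := by
        by_contra hne
        rcases lt_or_gt_of_ne hne with h | h <;> nlinarith
      subst hnn
      have : a' = a := Fin.ext (by omega)
      subst this
      exact ⟨rfl, hx⟩
    refine le_trans ?_ (ncard_le_ordCover A ((e ^ (n - (((a : ℕ) % p * N : ℕ) : ℤ))) x))
    rw [← Set.ncard_coe_finset]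
    refine Set.ncard_le_ncard_of_injOn Prod.snd (fun i hi => (huniq i hi).2) ?_ (Set.toFinite _)
    intro i hi i' hi' h
    exact Prod.ext ((huniq i hi).1.trans (huniq i' hi').1.symm) h
  set J := Finset.Ico (⌈(L : ℝ) * t⌉ - p - 1) ⌈(L : ℝ) * t⌉ with hJ
  have hJc : J.card = p + 1 := by
    rw [hJ, Int.card_Ico]
    omega
  rw [← hJc, Set.ncard_eq_toFinset_card']
  refine (Finset.card_le_card ?_).trans (Finset.card_biUnion_le_card_mul J R _ fun b _ => hR b)
  intro i hi
  obtain ⟨n, hx, h1, h2⟩ := (mem_brick_iff hπ).1 (by simpa using hi)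
  refine Finset.mem_biUnion.2 ⟨i.1 - L * n, Finset.mem_Ico.2 ⟨?_, ?_⟩,
    Finset.mem_filter.2 ⟨Finset.mem_univ _, n, by ring, hx⟩⟩
  · have : ⌈(L : ℝ) * t⌉ ≤ ((i.1 : ℕ) : ℤ) - L * n + p + 1 := by
      rw [Int.ceil_le]
      push_cast
      linarith
    linarith
  · rw [Int.lt_ceil]
    push_cast
    linarith

theorem HasFineCovers.of_quotient [MetricSpace X] [CompactSpace X] [MetricSpace Y]
    [CompactSpace Y] {T : X ≃ₜ X} {S : Equiv.Perm Y} (hcont : Continuous π)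
    (hopen : IsOpenMap π) (hsurj : Function.Surjective π)
    (hπ : ∀ x t x' t', π (x, t) = π (x', t') ↔
      ∃ z : ℤ, x' = (T.toEquiv ^ z) x ∧ t' = t + z)
    (hS : ∀ x t, S (π (x, t)) = π (T.toEquiv⁻¹ x, t)) {d d' : ℝ} (hdd : d < d')
    (H : HasFineCovers T.toEquiv⁻¹ d) : HasFineCovers S d' := by
  classical
  have hd := H.1
  have hd' := hd.trans hdd
  refine .of_indexed hd' fun ε hε => ?_
  have hSpow : ∀ (z : ℕ) x t, (S ^ z) (π (x, t)) = π ((T.toEquiv⁻¹ ^ z) x, t) := by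
    intro z x t
    rw [← Equiv.Perm.iterate_eq_pow, ← Equiv.Perm.iterate_eq_pow]
    exact (Function.Semiconj.iterate_right (f := fun x => π (x, t))
      (fun x => (hS x t).symm) z x).symm
  obtain ⟨P, hP⟩ := exists_nat_gt (d / (d' - d))
  set p := P + 1 with hp
  have hpd : ((p : ℝ) + 1) * d ≤ p * d' := by
    rw [div_lt_iff₀ (by linarith)] at hP
    rw [hp]; push_cast
    nlinarith
  have hunif : UniformContinuousOn π (Set.univ ×ˢ Set.Icc (0 : ℝ) 2) :=
    (isCompact_univ.prod isCompact_Icc).uniformContinuousOn_of_continuous hcont.continuousOn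
  obtain ⟨δ, hδ, hπδ⟩ := Metric.uniformContinuousOn_iff.1 hunif ε hε
  obtain ⟨M, hM⟩ := exists_nat_gt (max 1 (2 / δ))
  have hM1 : (1 : ℝ) < M := (le_max_left _ _).trans_lt hM
  have hMδ : 2 < M * δ := by
    rw [← div_lt_iff₀ hδ]
    exact (le_max_right _ _).trans_lt hM
  set L := p * M with hLdef
  have hp0 : (1 : ℝ) ≤ p := by rw [hp]; push_cast; linarith [P.cast_nonneg (α := ℝ)]
  have hL : 0 < L := Nat.mul_pos (Nat.succ_pos P) (by exact_mod_cast zero_lt_one.trans hM1)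
  have hLR : (L : ℝ) = p * M := by rw [hLdef]; push_cast; rfl
  have hL0 : (0 : ℝ) < L := by exact_mod_cast hL
  obtain ⟨A, hA, hcov, hdist⟩ := H.exists_dist_lt hδ
  set N : ℕ := ⌈(ordCover A : ℝ) / d⌉₊
  obtain ⟨κ, hκ, W, hW, hWcov, href, hcard⟩ := exists_common_refinement
    (fun q (i : Fin L × A) =>
      if (i.1 : ℕ) % p = q then brick π T.toEquiv p L N i.1 i.2 else ∅)
    (fun q i => by
      split_ifs
      · exact isOpen_brick hopen _ _ _ _ (hA _ i.2.2)
      · exact isOpen_empty) P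
    (fun q hq y => by
      obtain ⟨⟨x, t⟩, rfl⟩ := hsurj y
      obtain ⟨a, haL, haq, s, hs, hx⟩ := exists_mem_brick hπ (N := N) hL (Dvd.intro M rfl)
        (Nat.lt_succ_of_le hq) hcov x t
      exact ⟨(⟨a, haL⟩, ⟨s, hs⟩), by simpa [haq] using hx⟩)
  refine ⟨κ, hκ, W, (p + 1) * ordCover A, hW, hWcov, fun y => ?_, fun z hz k y hy y' hy' => ?_⟩
  · obtain ⟨⟨x, t⟩, rfl⟩ := hsurj y
    refine (hcard _).trans (le_trans (le_of_eq ?_) (ncard_mem_brick_le hπ p L N A x t))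
    simp only [Set.ncard_eq_toFinset_card']
    rw [Finset.card_eq_sum_card_fiberwise (f := fun i : Fin L × A => (i.1 : ℕ) % p)
      (t := Finset.range (P + 1))
      (fun i _ => by simpa using Nat.mod_lt _ (Nat.succ_pos P))]
    refine Finset.sum_congr rfl fun q _ => congrArg _ ?_
    ext i
    by_cases h : (i.1 : ℕ) % p = q <;> simp [h]
  · have hzN : z < p * N := by
      by_contra! h
      have h1 : (ordCover A : ℝ) ≤ N * d := by
        rw [← div_le_iff₀ hd]
        exact Nat.le_ceil _
      have h2 : (p : ℝ) * N ≤ z := by exact_mod_cast h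
      push_cast at hz
      have h3 : (p : ℝ) * ordCover A ≤ z * d :=
        calc (p : ℝ) * ordCover A ≤ p * (N * d) := by gcongr
          _ = p * N * d := by ring
          _ ≤ z * d := by gcongr
      have h4 : (p : ℝ) * (z * d') < p * (((p : ℝ) + 1) * ordCover A) := by gcongr
      have h5 : ((p : ℝ) + 1) * (p * ordCover A) ≤ (p + 1) * (z * d) := by gcongr
      have h6 : (z : ℝ) * ((p + 1) * d) ≤ z * (p * d') := by gcongr
      linarith
    have hN : 0 < N := Nat.pos_of_ne_zero fun h => by simp [h] at hzN
    have hq : z / N < p := Nat.div_lt_of_lt_mul (by rwa [mul_comm] at hzN)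
    obtain ⟨⟨a, s⟩, hsub⟩ := href k (z / N) (Nat.le_of_lt_succ hq)
    have haq : (a : ℕ) % p = z / N := by
      by_contra h
      simpa [h] using hsub hy
    have hr : ((z % N : ℕ) : ℝ) * d < ordCover A := by
      rw [← lt_div_iff₀ hd, ← Nat.lt_ceil]
      exact Nat.mod_lt _ hN
    simp only [haq, if_true] at hsub
    obtain ⟨⟨x, t⟩, ⟨hx, h1, h2⟩, rfl⟩ := hsub hy
    obtain ⟨⟨x', t'⟩, ⟨hx', h1', h2'⟩, rfl⟩ := hsub hy'
    have haL : (a : ℝ) + 1 ≤ L := by exact_mod_cast a.2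
    have hpM : (p : ℝ) ≤ L := by rw [hLR]; nlinarith
    have hIcc : ∀ u : ℝ, (a : ℝ) < L * u → L * u < a + p + 1 → u ∈ Set.Icc (0 : ℝ) 2 := by
      intro u hu1 hu2
      have ha0 : (0 : ℝ) ≤ (a : ℕ) := Nat.cast_nonneg _
      constructor
      · exact (pos_of_mul_pos_right (ha0.trans_lt hu1) hL0.le).le
      · refine le_of_mul_le_mul_left ?_ hL0
        linarith
    have key : ∀ x : X, (T.toEquiv⁻¹ ^ z) x = (T.toEquiv⁻¹ ^ (z % N))
        ((T.toEquiv ^ (-(((a : ℕ) % p * N : ℕ) : ℤ))) x) := by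
      intro x
      rw [haq, ← inv_zpow', zpow_natCast, ← Equiv.Perm.mul_apply, ← pow_add, mul_comm,
        Nat.mod_add_div]
    rw [hSpow, hSpow]
    refine hπδ _ ⟨Set.mem_univ _, hIcc t h1 h2⟩ _ ⟨Set.mem_univ _, hIcc t' h1' h2'⟩ ?_
    rw [Prod.dist_eq, max_lt_iff, key, key]
    refine ⟨hdist _ hr s s.2 _ hx _ hx', ?_⟩
    have hLδ : (p : ℝ) + 1 < L * δ := by
      rw [hLR]
      nlinarith
    dsimp only at h1 h2 h1' h2' ⊢
    rw [Real.dist_eq, abs_sub_lt_iff]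
    constructor <;>
    · refine lt_of_mul_lt_mul_left ?_ hL0.le
      linarith

end Bricks

section Borel

variable {X : Type*} [TopologicalSpace X] (T : X ≃ₜ X)

theorem borelRel_equivalence : Equivalence (borelRel T) where
  refl p := ⟨0, by simp⟩
  symm := by
    rintro p q ⟨z, h1, h2⟩
    refine ⟨-z, ?_, by rw [h2]; push_cast; ring⟩
    rw [h1, ← Equiv.Perm.mul_apply, ← zpow_add]
    simp
  trans := by
    rintro p q r ⟨z, h1, h2⟩ ⟨w, h3, h4⟩
    refine ⟨w + z, ?_, by rw [h4, h2]; push_cast; ring⟩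
    rw [h3, h1, ← Equiv.Perm.mul_apply, ← zpow_add]

theorem borel_mk_eq_iff (p q : X × ℝ) :
    Quot.mk (borelRel T) p = Quot.mk (borelRel T) q ↔ borelRel T p q := by
  rw [Quot.eq, (borelRel_equivalence T).eqvGen_iff]

theorem isOpenMap_borel_mk :
    IsOpenMap (fun p => Quot.mk (borelRel T) p : X × ℝ → BorelConstruction T) := by
  intro U hU
  refine (isQuotientMap_quot_mk (r := borelRel T)).isOpen_preimage.1 ?_
  have : Quot.mk (borelRel T) ⁻¹' ((fun p => Quot.mk (borelRel T) p) '' U) =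
      ⋃ z : ℤ, (fun p : X × ℝ => ((T.toEquiv ^ z) p.1, p.2 + z)) ⁻¹' U := by
    ext p
    simp only [Set.mem_preimage, Set.mem_image, Set.mem_iUnion]
    constructor
    · rintro ⟨q, hq, hqp⟩
      obtain ⟨z, h1, h2⟩ := (borel_mk_eq_iff T p q).1 hqp.symm
      exact ⟨z, by rwa [← h1, ← h2]⟩
    · rintro ⟨z, hz⟩
      exact ⟨_, hz, ((borel_mk_eq_iff T p _).2 ⟨z, rfl, rfl⟩).symm⟩
  rw [this]
  refine isOpen_iUnion fun z => hU.preimage ?_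
  exact ((T.continuous_toEquiv_zpow z).comp continuous_fst).prodMk (by fun_prop)

end Borel

/-- Theorem 2 of the paper: `mdim (X ×_ℤ ℝ) = mdim X`, where `X ×_ℤ ℝ` carries the
ℤ-action obtained by restricting the natural ℝ-action.  The (compact metrizable)
space `X ×_ℤ ℝ` is represented by any compact metric space `Y` equivariantly
homeomorphic to it. -/
theorem stmt_12 {X Y : Type*} [MetricSpace X] [CompactSpace X]
    [MetricSpace Y] [CompactSpace Y]
    (T : X ≃ₜ X) (S : Y ≃ₜ Y) (h : Y ≃ₜ BorelConstruction T)
    (hequiv : ∀ y : Y, h (S y) = borelAct T 1 (h y)) :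
    mdim S = mdim T := by
  set π : X × ℝ → Y := fun p => h.symm (Quot.mk (borelRel T) p)
  have hcont : Continuous π := h.symm.continuous.comp continuous_quot_mk
  have hopen : IsOpenMap π := h.symm.isOpenMap.comp (isOpenMap_borel_mk T)
  have hsurj : Function.Surjective π := h.symm.surjective.comp Quot.mk_surjective
  have hπ : ∀ x t x' t', π (x, t) = π (x', t') ↔
      ∃ z : ℤ, x' = (T.toEquiv ^ z) x ∧ t' = t + z := fun x t x' t' =>
    h.symm.injective.eq_iff.trans (borel_mk_eq_iff T _ _)
  have hS : ∀ x t, S.toEquiv (π (x, t)) = π (T.toEquiv⁻¹ x, t) := fun x t => by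
    have hmk : ∀ p, h (π p) = Quot.mk (borelRel T) p := fun p => h.apply_symm_apply _
    refine h.injective ((hequiv _).trans ?_)
    rw [hmk, hmk]
    exact (borel_mk_eq_iff T (x, t + 1) (T.toEquiv⁻¹ x, t)).2 ⟨-1, by simp, by simp⟩
  have hsub : ∀ d, HasFineCovers S.toEquiv d → HasFineCovers T.toEquiv d := fun d hd => by
    have hinv : HasFineCovers T.symm.toEquiv d := by
      refine hd.of_injective (f := fun x => π (x, 0)) (by fun_prop) (fun x x' hx => ?_)
        fun x => (hS x 0).symm
      obtain ⟨z, h1, h2⟩ := (hπ _ _ _ _).1 hx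
      have hz : z = 0 := by
        rw [zero_add] at h2
        exact_mod_cast h2.symm
      rw [h1, hz]
      simp
    exact hinv.inv
  have hsup : ∀ d, HasFineCovers T.toEquiv d → ∀ d', d < d' → HasFineCovers S.toEquiv d' :=
    fun d hd d' hdd => hd.inv.of_quotient hcont hopen hsurj hπ hS hdd
  rw [mdim_eq_sInf, mdim_eq_sInf]
  rcases Set.eq_empty_or_nonempty {d | HasFineCovers T.toEquiv d} with h0 | hne
  · rw [h0, Set.subset_empty_iff.1 (h0 ▸ hsub : {d | HasFineCovers S.toEquiv d} ⊆ ∅)]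
  · have hne' : {d | HasFineCovers S.toEquiv d}.Nonempty :=
      hne.elim fun d hd => ⟨d + 1, hsup d hd _ (lt_add_one d)⟩
    refine le_antisymm (le_csInf hne fun d hd => ?_)
      (csInf_le_csInf ⟨0, fun d hd => hd.1.le⟩ hne' hsub)
    exact le_of_forall_gt_imp_ge_of_dense fun d' hd' =>
      csInf_le ⟨0, fun d hd => hd.1.le⟩ (hsup d hd d' hd')
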